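/- Let N ≥ 2 and let p : ℕ → ℝ be a positive sequence with p(n) → ∞ and p(n)/n^{1/6} → 0. Then the proportion of words w ∈ W_n^{(N)} for which ρ∞(w, wst) ≥ p(n)/√n, i.e., #{w ∈ W_n^{(N)} : ρ∞(w, wst) ≥ p(n)/√n} divided by the multinomial coefficient (N·n)!/(n!)^N, tends to 0 as n → ∞. -/

import Mathlib

/-- The number of occurrences of the letter `k` among the first `j` letters of the word
`w : Fin m → Fin N`. -/
def countLetterN (m N : ℕ) (w : Fin m → Fin N) (k : Fin N) (j : ℕ) : ℕ :=
  (Finset.univ.filter fun i : Fin m => (i : ℕ) < j ∧ w i = k).card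

/-- `w` is a word in `W_n^{(N)}`: a word of length `N·n` in the `N` letters `A₁, …, A_N`
(encoded as `Fin N`) containing exactly `n` occurrences of each letter. -/
def IsWordN (N n : ℕ) (w : Fin (N * n) → Fin N) : Prop :=
  ∀ k : Fin N, (Finset.univ.filter fun i : Fin (N * n) => w i = k).card = n

/-- `ρ∞(w, v) = (2/n)·max_{1 ≤ k ≤ N, 1 ≤ j ≤ N·n} |w_{A_k}[j] − v_{A_k}[j]|`. -/
noncomputable def rhoInfN (N n : ℕ) (w v : Fin (N * n) → Fin N) : ℝ :=
  (2 / (n : ℝ)) * (((Finset.Icc 1 (N * n)) ×ˢ (Finset.univ : Finset (Fin N))).sup fun p =>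
    ((countLetterN (N * n) N w p.2 p.1 : ℤ) - (countLetterN (N * n) N v p.2 p.1 : ℤ)).natAbs :
      ℕ)

/-- The standard word `wst ∈ W_n^{(N)}`: the word `A₁A₂…A_N` repeated `n` times. -/
def wstN (N n : ℕ) (hN : 0 < N) : Fin (N * n) → Fin N :=
  fun i => ⟨(i : ℕ) % N, Nat.mod_lt _ hN⟩

section Exchangeable

open Finset

variable {α : Type*} {m : ℕ}

/-- The sum of `f` over the first `j` letters of `w`. -/
noncomputable def partialSum (f : α → ℝ) (w : Fin m → α) (j : ℕ) : ℝ :=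
  ∑ i ∈ univ.filter (fun i : Fin m => (i : ℕ) < j), f (w i)

lemma partialSum_zero (f : α → ℝ) (w : Fin m → α) : partialSum f w 0 = 0 := by
  simp [partialSum]

lemma partialSum_succ (f : α → ℝ) (w : Fin m → α) (i : Fin m) :
    partialSum f w (i + 1) = partialSum f w i + f (w i) := by
  have h : (univ.filter fun l : Fin m => (l : ℕ) < i + 1) =
      insert i (univ.filter fun l : Fin m => (l : ℕ) < i) := by
    ext l
    simp only [mem_filter, mem_univ, true_and, mem_insert, Fin.ext_iff]
    omega
  rw [partialSum, partialSum, h, sum_insert (by simp), add_comm]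

lemma partialSum_add_sum_ge (f : α → ℝ) (w : Fin m → α) (j : ℕ) :
    partialSum f w j + ∑ i ∈ univ.filter (fun i : Fin m => j ≤ (i : ℕ)), f (w i) = ∑ i, f (w i) := by
  rw [partialSum, ← sum_filter_add_sum_filter_not univ (fun i : Fin m => (i : ℕ) < j)]
  simp only [not_lt]

lemma card_filter_ge (j : ℕ) (hj : j ≤ m) :
    ((univ.filter fun i : Fin m => j ≤ (i : ℕ)).card : ℝ) = m - j := by
  have h := card_filter_add_card_filter_not (s := (univ : Finset (Fin m))) (fun i => (i : ℕ) < j)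
  simp only [not_lt, card_univ, Fintype.card_fin, Fin.card_filter_val_lt, min_eq_right hj] at h
  rw [eq_sub_iff_add_eq']
  exact_mod_cast h

lemma partialSum_swap (f : α → ℝ) (w : Fin m → α) {j l : ℕ} (hl : l ≤ j) {a b : Fin m}
    (ha : j ≤ a) (hb : j ≤ b) : partialSum f (w ∘ Equiv.swap a b) l = partialSum f w l := by
  refine sum_congr rfl fun i hi => ?_
  have hi : (i : ℕ) < l := by simpa using hi
  rw [Function.comp_apply, Equiv.swap_apply_of_ne_of_ne]
  · rintro rfl; omega
  · rintro rfl; omega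

lemma partialSum_comp_rev (f : α → ℝ) (w : Fin m → α) (hw : ∑ i, f (w i) = 0) {j : ℕ}
    (hj : j ≤ m) : partialSum f (w ∘ Fin.rev) (m - j) = -partialSum f w j := by
  have h : partialSum f (w ∘ Fin.rev) (m - j) = ∑ i ∈ univ.filter (fun i : Fin m => j ≤ (i : ℕ)), f (w i) := by
    refine sum_nbij' Fin.rev Fin.rev ?_ ?_ ?_ ?_ ?_
    · intro i hi
      simp only [mem_filter, mem_univ, true_and, Fin.val_rev] at hi ⊢
      omega
    · intro i hi
      simp only [mem_filter, mem_univ, true_and, Fin.val_rev] at hi ⊢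
      omega
    · simp
    · simp
    · simp
  rw [h]
  linarith [partialSum_add_sum_ge f w j]

/-- In a family of words with zero total sum that is closed under transpositions of positions
`≥ j`, each letter past `j` carries the average of what is missing to zero. -/
lemma sum_partialSum_mul_apply (f : α → ℝ) (E : Finset (Fin m → α)) {j : ℕ}
    (hE : ∀ w ∈ E, ∀ a b : Fin m, j ≤ a → j ≤ b → w ∘ Equiv.swap a b ∈ E)
    (h0 : ∀ w ∈ E, ∑ i, f (w i) = 0) (i : Fin m) (hi : j ≤ i) :
    ((m : ℝ) - j) * ∑ w ∈ E, partialSum f w j * f (w i) = -∑ w ∈ E, partialSum f w j ^ 2 := by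
  have hswap : ∀ l : Fin m, j ≤ l →
      ∑ w ∈ E, partialSum f w j * f (w l) = ∑ w ∈ E, partialSum f w j * f (w i) := by
    intro l hl
    refine sum_nbij' (fun w => w ∘ Equiv.swap i l) (fun w => w ∘ Equiv.swap i l)
      (fun w hw => hE w hw i l hi hl) (fun w hw => hE w hw i l hi hl) ?_ ?_ ?_
    · intro w _
      ext x
      simp
    · intro w _
      ext x
      simp
    · intro w _
      rw [partialSum_swap f w le_rfl hi hl]
      simp
  rw [← card_filter_ge j (hi.trans i.2.le), ← nsmul_eq_mul, ← sum_const,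
    ← sum_congr rfl (fun l hl => hswap l (by simpa using hl)), sum_comm, ← sum_neg_distrib]
  refine sum_congr rfl fun w hw => ?_
  rw [← mul_sum, show ∑ l ∈ univ.filter (fun l : Fin m => j ≤ (l : ℕ)), f (w l) = -partialSum f w j by
    linarith [partialSum_add_sum_ge f w j, h0 w hw]]
  ring

lemma sum_partialSum_mul_partialSum (f : α → ℝ) (E : Finset (Fin m → α)) {j : ℕ}
    (hE : ∀ w ∈ E, ∀ a b : Fin m, j ≤ a → j ≤ b → w ∘ Equiv.swap a b ∈ E)
    (h0 : ∀ w ∈ E, ∑ i, f (w i) = 0) {h : ℕ} (hjh : j ≤ h) (hh : h ≤ m) :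
    ((m : ℝ) - j) * ∑ w ∈ E, partialSum f w j * partialSum f w h =
      (m - h) * ∑ w ∈ E, partialSum f w j ^ 2 := by
  induction h, hjh using Nat.le_induction with
  | base => simp only [sq]
  | succ h hjh ih =>
    have hs := sum_partialSum_mul_apply f E hE h0 ⟨h, hh⟩ hjh
    have h1 : ∀ w : Fin m → α, partialSum f w (h + 1) = partialSum f w h + f (w ⟨h, hh⟩) :=
      fun w => partialSum_succ f w ⟨h, hh⟩
    simp only [h1, mul_add, sum_add_distrib]
    rw [ih (by omega), hs]
    push_cast
    ring

lemma sum_sq_partialSum_le_four_mul (f : α → ℝ) (E : Finset (Fin m → α)) {j h : ℕ}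
    (hE : ∀ w ∈ E, ∀ a b : Fin m, j ≤ a → j ≤ b → w ∘ Equiv.swap a b ∈ E)
    (h0 : ∀ w ∈ E, ∑ i, f (w i) = 0) (hjh : j ≤ h) (hh : 2 * h ≤ m) (hm : 0 < m) :
    ∑ w ∈ E, partialSum f w j ^ 2 ≤ 4 * ∑ w ∈ E, partialSum f w h ^ 2 := by
  have hcross := sum_partialSum_mul_partialSum f E hE h0 hjh (by omega)
  have hsq : 0 ≤ ∑ w ∈ E, (((m : ℝ) - j) * partialSum f w h - (m - h) * partialSum f w j) ^ 2 :=
    sum_nonneg fun _ _ => sq_nonneg _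
  have hexp : ∑ w ∈ E, (((m : ℝ) - j) * partialSum f w h - (m - h) * partialSum f w j) ^ 2 =
      ((m : ℝ) - j) ^ 2 * ∑ w ∈ E, partialSum f w h ^ 2 -
        2 * (m - h) * ((m - j) * ∑ w ∈ E, partialSum f w j * partialSum f w h) +
        (m - h) ^ 2 * ∑ w ∈ E, partialSum f w j ^ 2 := by
    simp only [mul_sum, ← sum_sub_distrib, ← sum_add_distrib]
    exact sum_congr rfl fun _ _ => by ring
  rw [hexp, hcross] at hsq
  have hA : 0 ≤ ∑ w ∈ E, partialSum f w j ^ 2 := sum_nonneg fun _ _ => sq_nonneg _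
  have hB : 0 ≤ ∑ w ∈ E, partialSum f w h ^ 2 := sum_nonneg fun _ _ => sq_nonneg _
  have hjh' : (j : ℝ) ≤ h := by exact_mod_cast hjh
  have hh' : 2 * (h : ℝ) ≤ m := by exact_mod_cast hh
  have hm' : (0 : ℝ) < m := by exact_mod_cast hm
  have hj' : (0 : ℝ) ≤ j := j.cast_nonneg
  have h1 : ((m : ℝ) - j) ^ 2 ≤ 4 * (m - h) ^ 2 := by nlinarith
  have h2 : (0 : ℝ) < (m - h) ^ 2 := by
    have : (0 : ℝ) < m - h := by linarith
    positivity
  refine le_of_mul_le_mul_left ?_ h2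
  nlinarith [mul_le_mul_of_nonneg_right h1 hB]

lemma sum_sq_partialSum_le (f : α → ℝ) (hf : ∀ a, f a ^ 2 ≤ 1) (W : Finset (Fin m → α))
    (hW : ∀ w ∈ W, ∀ σ : Equiv.Perm (Fin m), w ∘ σ ∈ W)
    (h0 : ∀ w ∈ W, ∑ i, f (w i) = 0) {j : ℕ} (hj : j ≤ m) :
    ∑ w ∈ W, partialSum f w j ^ 2 ≤ j * W.card := by
  induction j with
  | zero => simp [partialSum_zero]
  | succ j ih =>
    have hs := sum_partialSum_mul_apply f W (j := j) (fun w hw a b _ _ => hW w hw _) h0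
      ⟨j, hj⟩ le_rfl
    have h1 : ∀ w : Fin m → α, partialSum f w (j + 1) = partialSum f w j + f (w ⟨j, hj⟩) :=
      fun w => partialSum_succ f w ⟨j, hj⟩
    have hexp : ∑ w ∈ W, partialSum f w (j + 1) ^ 2 = ∑ w ∈ W, partialSum f w j ^ 2 +
        2 * ∑ w ∈ W, partialSum f w j * f (w ⟨j, hj⟩) + ∑ w ∈ W, f (w ⟨j, hj⟩) ^ 2 := by
      simp only [mul_sum, ← sum_add_distrib, h1]
      exact sum_congr rfl fun _ _ => by ring
    have hA : 0 ≤ ∑ w ∈ W, partialSum f w j ^ 2 := sum_nonneg fun _ _ => sq_nonneg _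
    have hmj : (0 : ℝ) < m - j := by
      have : (j : ℝ) < m := by exact_mod_cast hj
      linarith
    have hneg : ∑ w ∈ W, partialSum f w j * f (w ⟨j, hj⟩) ≤ 0 := by
      by_contra! hc
      nlinarith [mul_pos hmj hc]
    have hvar : ∑ w ∈ W, f (w ⟨j, hj⟩) ^ 2 ≤ W.card := by
      simpa using sum_le_card_nsmul W (fun w => f (w ⟨j, hj⟩) ^ 2) 1 fun w _ => hf _
    have := ih (by omega)
    push_cast
    linarith

open scoped Classical in
lemma card_exists_partialSum_first_half (f : α → ℝ) (hf : ∀ a, f a ^ 2 ≤ 1)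
    (W : Finset (Fin m → α)) (hW : ∀ w ∈ W, ∀ σ : Equiv.Perm (Fin m), w ∘ σ ∈ W)
    (h0 : ∀ w ∈ W, ∑ i, f (w i) = 0) (hm : 0 < m) {t : ℝ} (ht : 0 ≤ t) :
    t ^ 2 * (W.filter fun w => ∃ j ≤ m / 2, t ≤ |partialSum f w j|).card ≤ 2 * m * W.card := by
  set h := m / 2 with hh
  let E : ℕ → Finset (Fin m → α) := fun j =>
    W.filter fun w => t ≤ |partialSum f w j| ∧ ∀ l < j, |partialSum f w l| < t
  have hdisj : (↑(range (h + 1)) : Set ℕ).PairwiseDisjoint E := by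
    intro a _ b _ hab
    refine disjoint_left.2 fun w hwa hwb => ?_
    simp only [E, mem_filter] at hwa hwb
    rcases lt_or_gt_of_ne hab with hlt | hlt
    · exact absurd (hwb.2.2 a hlt) (not_lt.2 hwa.2.1)
    · exact absurd (hwa.2.2 b hlt) (not_lt.2 hwb.2.1)
  have hcover : (W.filter fun w => ∃ j ≤ h, t ≤ |partialSum f w j|) ⊆ (range (h + 1)).biUnion E := by
    intro w hw
    obtain ⟨hwW, hex⟩ := mem_filter.1 hw
    have hs := Nat.find_spec hex
    refine mem_biUnion.2 ⟨Nat.find hex, mem_range.2 (by omega), mem_filter.2 ⟨hwW, hs.2, ?_⟩⟩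
    intro l hl
    have := Nat.find_min hex hl
    push Not at this
    exact this (by omega)
  have hEj : ∀ j ∈ range (h + 1), t ^ 2 * ((E j).card : ℝ) ≤
      4 * ∑ w ∈ E j, partialSum f w h ^ 2 := by
    intro j hj
    have hj : j ≤ h := by simpa [Nat.lt_succ_iff] using hj
    refine le_trans ?_ (sum_sq_partialSum_le_four_mul f (E j) (j := j) ?_ ?_ hj (by omega) hm)
    · rw [mul_comm, ← nsmul_eq_mul]
      refine card_nsmul_le_sum _ _ _ fun w hw => ?_
      rw [← sq_abs (partialSum f w j)]
      exact pow_le_pow_left₀ ht (mem_filter.1 hw).2.1 2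
    · intro w hw a b ha hb
      obtain ⟨hwW, hw1, hw2⟩ := mem_filter.1 hw
      refine mem_filter.2 ⟨hW w hwW _, ?_, fun l hl => ?_⟩
      · rwa [partialSum_swap f w le_rfl ha hb]
      · rw [partialSum_swap f w hl.le ha hb]
        exact hw2 l hl
    · exact fun w hw => h0 w (mem_filter.1 hw).1
  have hsub : (range (h + 1)).biUnion E ⊆ W :=
    biUnion_subset.2 fun j _ => filter_subset _ _
  calc t ^ 2 * ((W.filter fun w => ∃ j ≤ h, t ≤ |partialSum f w j|).card : ℝ)
      ≤ t ^ 2 * ∑ j ∈ range (h + 1), ((E j).card : ℝ) := by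
        gcongr
        exact_mod_cast (card_le_card hcover).trans card_biUnion_le
    _ ≤ ∑ j ∈ range (h + 1), 4 * ∑ w ∈ E j, partialSum f w h ^ 2 := by
        rw [mul_sum]
        exact sum_le_sum hEj
    _ = 4 * ∑ w ∈ (range (h + 1)).biUnion E, partialSum f w h ^ 2 := by
        rw [← mul_sum, sum_biUnion hdisj]
    _ ≤ 4 * ∑ w ∈ W, partialSum f w h ^ 2 := by
        gcongr
    _ ≤ 4 * (h * W.card) := by
        gcongr
        exact sum_sq_partialSum_le f hf W hW h0 (by omega)
    _ ≤ 2 * m * W.card := by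
        have : 2 * (h : ℝ) ≤ m := by exact_mod_cast (by omega : 2 * h ≤ m)
        nlinarith [(Nat.cast_nonneg W.card : (0 : ℝ) ≤ W.card)]

open scoped Classical in
/-- A Kolmogorov-type maximal inequality for exchangeable families of words. -/
lemma card_exists_partialSum_le (f : α → ℝ) (hf : ∀ a, f a ^ 2 ≤ 1)
    (W : Finset (Fin m → α)) (hW : ∀ w ∈ W, ∀ σ : Equiv.Perm (Fin m), w ∘ σ ∈ W)
    (h0 : ∀ w ∈ W, ∑ i, f (w i) = 0) (hm : 0 < m) {t : ℝ} (ht : 0 ≤ t) :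
    t ^ 2 * (W.filter fun w => ∃ j ≤ m, t ≤ |partialSum f w j|).card ≤ 4 * m * W.card := by
  set A := W.filter fun w => ∃ j ≤ m / 2, t ≤ |partialSum f w j|
  have hsub : (W.filter fun w => ∃ j ≤ m, t ≤ |partialSum f w j|) ⊆
      A ∪ A.image fun w => w ∘ Fin.rev := by
    intro w hw
    obtain ⟨hwW, j, hj, hwj⟩ := mem_filter.1 hw
    rcases le_or_gt j (m / 2) with h | h
    · exact mem_union_left _ (mem_filter.2 ⟨hwW, j, h, hwj⟩)
    · refine mem_union_right _ (mem_image.2 ⟨w ∘ Fin.rev, mem_filter.2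
        ⟨hW w hwW Fin.revPerm, m - j, by omega, ?_⟩, ?_⟩)
      · rwa [partialSum_comp_rev f w (h0 w hwW) hj, abs_neg]
      · ext x
        simp
  have hcard : ((W.filter fun w => ∃ j ≤ m, t ≤ |partialSum f w j|).card : ℝ) ≤
      A.card + A.card := by
    exact_mod_cast (card_le_card hsub).trans
      ((card_union_le _ _).trans (Nat.add_le_add_left card_image_le _))
  have := card_exists_partialSum_first_half f hf W hW h0 hm ht
  nlinarith [mul_le_mul_of_nonneg_left hcard (sq_nonneg t)]

end Exchangeable

section Words

open Finset

lemma IsWordN.comp_perm {N n : ℕ} {w : Fin (N * n) → Fin N} (hw : IsWordN N n w)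
    (σ : Equiv.Perm (Fin (N * n))) : IsWordN N n (w ∘ σ) := by
  intro k
  exact (card_equiv σ (by simp)).trans (hw k)

open scoped Classical in
lemma card_words_mul_factorial_le (N n : ℕ) :
    (univ.filter fun w => IsWordN N n w).card * (n.factorial) ^ N ≤ (N * n).factorial := by
  rcases (univ.filter fun w => IsWordN N n w).eq_empty_or_nonempty with h | ⟨w₀, hw₀⟩
  · simp [h]
  have hfib : ∀ w, IsWordN N n w → ∀ k, Fintype.card {a // w a = k} = n := fun w hw k => by
    rw [Fintype.card_subtype, hw k]
  have hw₀ : IsWordN N n w₀ := (mem_filter.1 hw₀).2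
  have hσ : ∀ w : {w // IsWordN N n w}, ∃ σ : Equiv.Perm (Fin (N * n)), w₀ ∘ σ = w.1 := by
    intro w
    refine ⟨Equiv.ofFiberEquiv (f := w.1) (g := w₀) fun k => Fintype.equivOfCardEq ?_, ?_⟩
    · rw [hfib _ w.2, hfib _ hw₀]
    · funext a
      exact Equiv.ofFiberEquiv_map _ a
  choose σ hσ using hσ
  have hstab : Fintype.card {g : Equiv.Perm (Fin (N * n)) // w₀ ∘ g = w₀} = n.factorial ^ N := by
    rw [DomMulAct.stabilizer_card]
    simp [hfib _ hw₀]
  rw [← hstab, ← Fintype.card_subtype, ← Fintype.card_prod]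
  calc _ ≤ Fintype.card (Equiv.Perm (Fin (N * n))) := ?_
    _ = _ := by rw [Fintype.card_perm, Fintype.card_fin]
  refine Fintype.card_le_of_injective (fun x => x.2.1 * σ x.1) ?_
  have hrec : ∀ x : {w // IsWordN N n w} × {g : Equiv.Perm (Fin (N * n)) // w₀ ∘ g = w₀},
      w₀ ∘ (x.2.1 * σ x.1 : Equiv.Perm (Fin (N * n))) = x.1.1 := by
    intro x
    rw [Equiv.Perm.coe_mul, ← Function.comp_assoc, x.2.2, hσ]
  rintro x y hxy
  have h1 : x.1 = y.1 := by
    apply Subtype.ext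
    rw [← hrec x, ← hrec y]
    exact congrArg (fun τ : Equiv.Perm (Fin (N * n)) => w₀ ∘ τ) hxy
  refine Prod.ext h1 (Subtype.ext ?_)
  simpa [h1] using hxy

/-- The centred indicator of the letter `k`. -/
noncomputable def centredIndicator (N : ℕ) (k : Fin N) (a : Fin N) : ℝ :=
  (if a = k then 1 else 0) - 1 / N

lemma centredIndicator_sq_le (N : ℕ) (k a : Fin N) : centredIndicator N k a ^ 2 ≤ 1 := by
  have hN : (1 : ℝ) ≤ N := by exact_mod_cast k.pos
  have h1 : 1 / (N : ℝ) ≤ 1 := by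
    rw [div_le_one (by linarith)]
    exact hN
  have h2 : 0 ≤ 1 / (N : ℝ) := by positivity
  rw [centredIndicator]
  split_ifs <;> nlinarith

lemma partialSum_centredIndicator {m N : ℕ} (w : Fin m → Fin N) (k : Fin N) {j : ℕ} (hj : j ≤ m) :
    partialSum (centredIndicator N k) w j = countLetterN m N w k j - (j : ℝ) / N := by
  simp only [partialSum, centredIndicator, sum_sub_distrib, sum_const, countLetterN,
    Fin.card_filter_val_lt, min_eq_right hj, sum_boole, filter_filter, nsmul_eq_mul]
  ring

lemma IsWordN.sum_centredIndicator {N n : ℕ} {w : Fin (N * n) → Fin N} (hw : IsWordN N n w)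
    (k : Fin N) : ∑ i, centredIndicator N k (w i) = 0 := by
  have hN : (N : ℝ) ≠ 0 := by exact_mod_cast k.pos.ne'
  simp only [centredIndicator, sum_sub_distrib, sum_boole, hw k, sum_const, card_univ,
    Fintype.card_fin, nsmul_eq_mul]
  push_cast
  field_simp
  ring

lemma abs_countLetterN_wstN_sub_le {N n : ℕ} (hN : 0 < N) (k : Fin N) {j : ℕ} (hj : j ≤ N * n) :
    |(countLetterN (N * n) N (wstN N n hN) k j : ℝ) - (j : ℝ) / N| ≤ 1 := by
  have hc : countLetterN (N * n) N (wstN N n hN) k j = j.count (· ≡ k [MOD N]) := by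
    rw [Nat.count_eq_card_filter_range, countLetterN]
    refine card_nbij (fun i : Fin (N * n) => (i : ℕ)) ?_ ?_ ?_
    · intro i hi
      simp only [coe_filter, mem_univ, true_and, Set.mem_ofPred_eq, mem_range,
        wstN, Fin.ext_iff, Nat.ModEq, Nat.mod_eq_of_lt k.2] at hi ⊢
      exact hi
    · exact fun a _ b _ h => Fin.ext h
    · intro i hi
      simp only [coe_filter, mem_range, Set.mem_ofPred_eq, Nat.ModEq, Nat.mod_eq_of_lt k.2] at hi
      exact ⟨⟨i, by omega⟩, by simpa [wstN, Fin.ext_iff] using hi, rfl⟩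
  rw [hc, Nat.count_modEq_card _ hN]
  have hN' : (0 : ℝ) < N := by exact_mod_cast hN
  have h1 : ((j / N : ℕ) : ℝ) ≤ j / N := Nat.cast_div_le
  have h2 : (j : ℝ) / N ≤ (j / N : ℕ) + 1 := by
    rw [div_le_iff₀ hN']
    exact_mod_cast (Nat.lt_div_mul_add (a := j) hN).le.trans (by rw [add_mul, one_mul])
  rw [abs_le]
  push_cast
  split_ifs <;> constructor <;> linarith

lemma exists_le_abs_partialSum_of_le_rhoInfN {N n : ℕ} (hN : 0 < N) (hn : 0 < n)
    {w : Fin (N * n) → Fin N} {x : ℝ} (hx : 4 ≤ x * n)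
    (h : x ≤ rhoInfN N n w (wstN N n hN)) :
    ∃ k : Fin N, ∃ j ≤ N * n, x * n / 4 ≤ |partialSum (centredIndicator N k) w j| := by
  have hne : ((Icc 1 (N * n)) ×ˢ (univ : Finset (Fin N))).Nonempty :=
    ⟨(1, ⟨0, hN⟩), by simpa [Nat.one_le_iff_ne_zero] using ⟨hN.ne', hn.ne'⟩⟩
  obtain ⟨⟨j, k⟩, hjk, hsup⟩ := exists_mem_eq_sup _ hne fun p : ℕ × Fin N =>
    ((countLetterN (N * n) N w p.2 p.1 : ℤ) -
      (countLetterN (N * n) N (wstN N n hN) p.2 p.1 : ℤ)).natAbs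
  have hj : j ≤ N * n := by
    simp only [mem_product, mem_Icc] at hjk
    exact hjk.1.2
  refine ⟨k, j, hj, ?_⟩
  rw [rhoInfN, hsup, Nat.cast_natAbs] at h
  push_cast at h
  have hn' : (0 : ℝ) < n := by exact_mod_cast hn
  rw [div_mul_eq_mul_div, le_div_iff₀ hn'] at h
  rw [partialSum_centredIndicator w k hj]
  have h1 := abs_countLetterN_wstN_sub_le hN k hj
  have h2 := abs_sub_le (countLetterN (N * n) N w k j : ℝ) ((j : ℝ) / N)
    (countLetterN (N * n) N (wstN N n hN) k j)
  rw [abs_sub_comm ((j : ℝ) / N)] at h2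
  linarith

open scoped Classical in
lemma card_far_from_wstN_le {N n : ℕ} (hN : 0 < N) (hn : 0 < n) {x : ℝ} (hx : 4 ≤ x * n) :
    (x * n / 4) ^ 2 * (univ.filter fun w => IsWordN N n w ∧
        x ≤ rhoInfN N n w (wstN N n hN)).card ≤
      4 * N ^ 2 * n * (univ.filter fun w => IsWordN N n w).card := by
  set W := univ.filter fun w => IsWordN N n w with hW
  have hsub : (univ.filter fun w => IsWordN N n w ∧ x ≤ rhoInfN N n w (wstN N n hN)) ⊆
      univ.biUnion fun k : Fin N => W.filter fun w =>
        ∃ j ≤ N * n, x * n / 4 ≤ |partialSum (centredIndicator N k) w j| := by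
    intro w hw
    obtain ⟨hw, hxw⟩ := (mem_filter.1 hw).2
    obtain ⟨k, hk⟩ := exists_le_abs_partialSum_of_le_rhoInfN hN hn hx hxw
    exact mem_biUnion.2 ⟨k, mem_univ _, mem_filter.2 ⟨mem_filter.2 ⟨mem_univ _, hw⟩, hk⟩⟩
  calc _ ≤ (x * n / 4) ^ 2 * ∑ k : Fin N, ((W.filter fun w =>
        ∃ j ≤ N * n, x * n / 4 ≤ |partialSum (centredIndicator N k) w j|).card : ℝ) := by
        gcongr
        exact_mod_cast (card_le_card hsub).trans card_biUnion_le
    _ ≤ ∑ _k : Fin N, 4 * ((N * n : ℕ) : ℝ) * W.card := by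
        rw [mul_sum]
        refine sum_le_sum fun k _ => ?_
        refine card_exists_partialSum_le _ (centredIndicator_sq_le N k) W ?_ ?_
          (Nat.mul_pos hN hn) (by linarith)
        · exact fun w hw σ => mem_filter.2 ⟨mem_univ _, (mem_filter.1 hw).2.comp_perm σ⟩
        · exact fun w hw => (mem_filter.1 hw).2.sum_centredIndicator k
    _ = _ := by
        simp only [sum_const, card_univ, Fintype.card_fin, nsmul_eq_mul]
        push_cast
        ring

end Words

/-- Let `N ≥ 2` and let `p` be a positive sequence with `p(n) → ∞` and `p(n) = o(n^{1/6})`.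
Then the proportion of words `w ∈ W_n^{(N)}` with `ρ∞(w, wst) ≥ p(n)/√n` (out of the
total number `(N·n)!/(n!)^N` of words) tends to `0` as `n → ∞`. -/
theorem proportion_far_from_standard_tendsto_zero (N : ℕ) (hN : 2 ≤ N)
    (p : ℕ → ℝ) (hpos : ∀ n, 0 < p n)
    (htop : Filter.Tendsto p Filter.atTop Filter.atTop)
    (hsmall : Filter.Tendsto (fun n : ℕ => p n / (n : ℝ) ^ ((1 : ℝ) / 6))
      Filter.atTop (nhds 0)) :
    Filter.Tendsto
      (fun n : ℕ =>
        (Nat.card {w : Fin (N * n) → Fin N // IsWordN N n w ∧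
            p n / Real.sqrt n ≤ rhoInfN N n w (wstN N n (by omega))} : ℝ) /
          ((Nat.factorial (N * n) : ℝ) / (Nat.factorial n : ℝ) ^ N))
      Filter.atTop (nhds 0) := by
  classical
  have hbound : Filter.Tendsto (fun n : ℕ => 64 * (N : ℝ) ^ 2 / p n ^ 2) Filter.atTop (nhds 0) :=
    Filter.Tendsto.const_div_atTop ((Filter.tendsto_pow_atTop two_ne_zero).comp htop) _
  refine squeeze_zero' (Filter.Eventually.of_forall fun n => by positivity) ?_ hbound
  filter_upwards [htop.eventually_ge_atTop 4, Filter.eventually_gt_atTop 0] with n hp hn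
  have hn' : (1 : ℝ) ≤ n := by exact_mod_cast hn
  have hs : 1 ≤ Real.sqrt n := Real.one_le_sqrt.2 hn'
  have hss : Real.sqrt n * Real.sqrt n = n := Real.mul_self_sqrt (by linarith)
  have hx : p n / Real.sqrt n * n = p n * Real.sqrt n := by
    rw [div_mul_eq_mul_div, div_eq_iff (by linarith), mul_assoc, hss]
  have hmain := card_far_from_wstN_le (N := N) (by omega) hn (x := p n / Real.sqrt n)
    (by rw [hx]; nlinarith)
  have hfact : ((Finset.univ.filter fun w => IsWordN N n w).card : ℝ) *
      (Nat.factorial n : ℝ) ^ N ≤ Nat.factorial (N * n) := by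
    exact_mod_cast card_words_mul_factorial_le N n
  have hf1 : (0 : ℝ) < (Nat.factorial n : ℝ) ^ N := by positivity
  have hf2 : (0 : ℝ) < (Nat.factorial (N * n) : ℝ) / (Nat.factorial n : ℝ) ^ N := by positivity
  rw [← le_div_iff₀ hf1] at hfact
  rw [Nat.card_eq_fintype_card, Fintype.card_subtype, div_le_iff₀ hf2, div_mul_eq_mul_div,
    le_div_iff₀ (pow_pos (hpos n) 2)]
  rw [hx, div_pow, mul_pow, Real.sq_sqrt (by linarith)] at hmain
  refine le_of_mul_le_mul_right ?_ (by linarith : (0 : ℝ) < n)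
  have := mul_le_mul_of_nonneg_left hfact (by positivity : (0 : ℝ) ≤ 64 * (N : ℝ) ^ 2 * n)
  linarith
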